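/- Let 𝒞 ⊆ [1, X) be a finite set of positive integers and V ≥ 1. The number of pairs (a₁, a₂) ∈ 𝒞² for which there exists a nonzero integer vector (v₁,v₂,v₃,v₄) ∈ [−V,V]⁴ with v₁a₁ + v₂a₂ + v₃X + v₄ = 0 is at most X^{o(1)}·( |𝒞|^{5/4}V² + |𝒞|^{3/2}V + |𝒞|^{3/2}V³/X^{1/2} ). -/

import Mathlib

theorem aux_divisor_bound (ε : ℝ) (hε : 0 < ε) : ∃ C : ℝ, 1 ≤ C ∧ ∀ n : ℕ, 1 ≤ n →
    (n.divisors.card : ℝ) ≤ C * (n : ℝ) ^ ε := by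
  obtain ⟨M, hM⟩ := exists_nat_ge ((2:ℝ) ^ (1/ε))
  set s : ℝ := (2:ℝ)^ε - 1 with hs
  have hspos : 0 < s := by
    have : (1:ℝ) < (2:ℝ)^ε := Real.one_lt_rpow (by norm_num) hε
    linarith
  set K : ℝ := max 1 (1/s) with hK
  have hK1 : 1 ≤ K := le_max_left _ _
  have hKs : 1 ≤ K * s := by
    have : 1/s ≤ K := le_max_right _ _
    rwa [div_le_iff₀ hspos] at this
  have key : ∀ p : ℕ, p.Prime → ∀ e : ℕ, ((e:ℝ)+1) ≤ (if p < M then K else 1) * ((p:ℝ)^e)^ε := by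
    intro p hp e
    have hp2 : (2:ℝ) ≤ p := by exact_mod_cast hp.two_le
    have hcomm : ((p:ℝ)^e)^ε = ((p:ℝ)^ε)^e := by
      rw [← Real.rpow_natCast, ← Real.rpow_natCast, ← Real.rpow_mul (by positivity),
        ← Real.rpow_mul (by positivity), mul_comm]
    rw [hcomm]
    split_ifs with h
    · have h1 : (1 + s) ≤ (p:ℝ)^ε := by
        have := Real.rpow_le_rpow (by norm_num) hp2 hε.le
        simp only [hs]; linarith
      have h2 : 1 + (e:ℝ) * s ≤ (1+s)^e := one_add_mul_le_pow (by linarith) e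
      have h3 : (1+s)^e ≤ ((p:ℝ)^ε)^e := by gcongr
      have h4 : (e:ℝ) + 1 ≤ K * (1 + e * s) := by
        have : (0:ℝ) ≤ e := by positivity
        nlinarith
      calc _ ≤ _ := h4
        _ ≤ _ := by gcongr; linarith
    · have h1 : (2:ℝ) ≤ (p:ℝ)^ε := by
        have hMp : (2:ℝ)^(1/ε) ≤ p := hM.trans (by exact_mod_cast not_lt.mp h)
        have := Real.rpow_le_rpow (by positivity) hMp hε.le
        rw [← Real.rpow_mul (by norm_num)] at this
        simpa [hε.ne'] using this
      have h3 : (2:ℝ)^e ≤ ((p:ℝ)^ε)^e := by gcongr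
      have h2 : (e:ℝ) + 1 ≤ 2^e := by
        exact_mod_cast (Nat.lt_two_pow_self (n := e))
      linarith
  refine ⟨K^M, one_le_pow₀ hK1, fun n hn => ?_⟩
  have hn0 : n ≠ 0 := by omega
  rw [Nat.card_divisors hn0]
  push_cast
  have hprod : (n:ℝ)^ε = ∏ p ∈ n.primeFactors, ((p:ℝ)^(n.factorization p))^ε := by
    rw [Real.finsetProd_rpow _ _ (fun i _ => by positivity)]
    congr 1
    conv_lhs => rw [← Nat.prod_factorization_pow_eq_self hn0]
    rw [Finsupp.prod, Nat.support_factorization]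
    push_cast; rfl
  calc _ ≤ ∏ p ∈ n.primeFactors, (if p < M then K else 1) * ((p:ℝ)^(n.factorization p))^ε := by
        apply Finset.prod_le_prod
        · intro i _; positivity
        · intro i hi; exact key i (Nat.prime_of_mem_primeFactors hi) _
    _ = (∏ p ∈ n.primeFactors, (if p < M then K else 1)) * (n:ℝ)^ε := by
        rw [Finset.prod_mul_distrib, hprod]
    _ ≤ _ := by
        gcongr
        rw [Finset.prod_ite]
        simp only [Finset.prod_const, one_pow, mul_one]
        apply pow_le_pow_right₀ hK1
        calc _ ≤ (Finset.range M).card := by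
              apply Finset.card_le_card
              intro p hp
              simp at hp ⊢
              exact hp.2
          _ = M := by simp

theorem aux_cell_range (h W x : ℤ) (hh : 1 ≤ h) (hx : |x| ≤ W) :
    x / h ∈ Finset.Icc (-(W/h) - 1) (W/h) := by
  rw [abs_le] at hx
  rw [Finset.mem_Icc]
  constructor
  · rw [Int.le_ediv_iff_mul_le (by omega)]
    have := Int.emod_lt_of_pos W (show 0 < h by omega)
    have := Int.mul_ediv_add_emod W h
    nlinarith
  · exact Int.ediv_le_ediv (by omega) hx.2

theorem aux_cell_same (h x y : ℤ) (hh : 1 ≤ h) (hxy : x / h = y / h) : |x - y| < h := by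
  have h1 := Int.emod_lt_of_pos x (show 0 < h by omega)
  have h2 := Int.emod_lt_of_pos y (show 0 < h by omega)
  have h3 := Int.emod_nonneg x (show h ≠ 0 by omega)
  have h4 := Int.emod_nonneg y (show h ≠ 0 by omega)
  have h5 := Int.mul_ediv_add_emod x h
  have h6 := Int.mul_ediv_add_emod y h
  rw [hxy] at h5
  rw [abs_lt]; constructor <;> linarith

theorem aux_cell1 {ι : Type*} (S : Finset ι) (f : ι → ℤ) (W h : ℕ) (hh : 1 ≤ h) (hW : h ≤ W)
    (hf : ∀ s ∈ S, |f s| ≤ W) (hsep : ∀ s ∈ S, ∀ s' ∈ S, |f s - f s'| < h → s = s') :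
    S.card * h ≤ 4 * W := by
  classical
  have hc : S.card ≤ (Finset.Icc (-((W:ℤ)/h) - 1) ((W:ℤ)/h)).card := by
    apply Finset.card_le_card_of_injOn (fun s => f s / (h:ℤ))
    · intro s hs
      exact aux_cell_range _ _ _ (by exact_mod_cast hh) (hf s hs)
    · intro s hs s' hs' he
      exact hsep s hs s' hs' (aux_cell_same _ _ _ (by exact_mod_cast hh) he)
  rw [Int.card_Icc] at hc
  have hd : (W:ℤ)/h = ((W/h : ℕ) : ℤ) := by simp
  rw [hd] at hc
  have hc2 : S.card ≤ 2 * (W/h) + 2 := by omega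
  have := Nat.div_mul_le_self W h
  calc S.card * h ≤ (2 * (W/h) + 2) * h := Nat.mul_le_mul_right _ hc2
    _ = 2 * (W/h*h) + 2 * h := by ring
    _ ≤ _ := by omega

theorem aux_cell2 {ι : Type*} (S : Finset ι) (x y t : ι → ℤ) (Z L : ℕ) (hL : 1 ≤ L) (hZ : L ≤ Z)
    (hx : ∀ s ∈ S, |x s| ≤ Z) (hy : ∀ s ∈ S, |y s| ≤ Z) (n1 n2 n3 : ℤ) (hn3 : n3 ≠ 0)
    (h1 : |n1| ≤ |n3|) (h2 : |n2| ≤ |n3|) (hn : ∀ s ∈ S, n1 * x s + n2 * y s + n3 * t s = 0)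
    (hsep : ∀ s ∈ S, ∀ s' ∈ S, |x s - x s'| < L → |y s - y s'| < L → |t s - t s'| < L → s = s') :
    S.card * L^2 ≤ 36 * Z^2 := by
  classical
  obtain ⟨h, hh⟩ : ∃ h : ℕ, h = (L+1)/2 := ⟨_, rfl⟩
  have hh1 : 1 ≤ h := by omega
  have hc : S.card ≤ ((Finset.Icc (-((Z:ℤ)/h) - 1) ((Z:ℤ)/h)) ×ˢ
      (Finset.Icc (-((Z:ℤ)/h) - 1) ((Z:ℤ)/h))).card := by
    apply Finset.card_le_card_of_injOn (fun s => (x s / (h:ℤ), y s / (h:ℤ)))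
    · intro s hs
      simp only [Finset.coe_product, Set.mem_prod, Finset.mem_coe]
      exact ⟨aux_cell_range _ _ _ (by exact_mod_cast hh1) (hx s hs),
        aux_cell_range _ _ _ (by exact_mod_cast hh1) (hy s hs)⟩
    · intro s hs s' hs' he
      simp only [Prod.mk.injEq] at he
      have e1 := aux_cell_same _ _ _ (by exact_mod_cast hh1) he.1
      have e2 := aux_cell_same _ _ _ (by exact_mod_cast hh1) he.2
      refine hsep s hs s' hs' (by omega) (by omega) ?_
      have e3 : n3 * (t s - t s') = -(n1 * (x s - x s')) - n2 * (y s - y s') := by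
        have := hn s hs; have := hn s' hs'; linarith
      have e4 : |n3| * |t s - t s'| ≤ |n3| * (2 * (h - 1)) := by
        rw [← abs_mul, e3]
        calc _ ≤ |-(n1 * (x s - x s'))| + |n2 * (y s - y s')| := abs_sub _ _
          _ = |n1| * |x s - x s'| + |n2| * |y s - y s'| := by rw [abs_neg, abs_mul, abs_mul]
          _ ≤ |n3| * (h-1) + |n3| * (h-1) := by
            gcongr <;> omega
          _ = _ := by ring
      have e5 := le_of_mul_le_mul_left e4 (abs_pos.mpr hn3)
      omega
  rw [Finset.card_product, Int.card_Icc] at hc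
  have hd : (Z:ℤ)/h = ((Z/h : ℕ) : ℤ) := by simp
  rw [hd] at hc
  have hq : (((Z/h:ℕ):ℤ) + 1 - (-((Z/h:ℕ):ℤ) - 1)).toNat = 2 * (Z/h) + 2 := by omega
  rw [hq] at hc
  have h3 := Nat.div_mul_le_self Z h
  have h4 : (2 * (Z/h) + 2) * L ≤ 6 * Z := by
    calc (2 * (Z/h) + 2) * L ≤ (2 * (Z/h)) * (2 * h) + 2 * L := by
          rw [add_mul]; gcongr; omega
      _ = 4 * (Z/h*h) + 2 * L := by ring
      _ ≤ _ := by omega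
  calc S.card * L^2 ≤ (2 * (Z/h) + 2) * (2 * (Z/h) + 2) * L^2 := Nat.mul_le_mul_right _ hc
    _ = ((2 * (Z/h) + 2) * L)^2 := by ring
    _ ≤ (6 * Z)^2 := by gcongr
    _ = _ := by ring

noncomputable def auxBox (Z : ℕ) : Finset (ℤ × ℤ × ℤ) :=
  Finset.Icc (-(Z:ℤ)) Z ×ˢ Finset.Icc (-(Z:ℤ)) Z ×ˢ Finset.Icc (-(Z:ℤ)) Z

theorem aux_mem_box (Z : ℕ) (s : ℤ × ℤ × ℤ) :
    s ∈ auxBox Z ↔ |s.1| ≤ Z ∧ |s.2.1| ≤ Z ∧ |s.2.2| ≤ Z := by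
  simp [auxBox, abs_le]

theorem aux_card_box (Z : ℕ) : (auxBox Z).card = (2*Z+1)^3 := by
  simp only [auxBox, Finset.card_product, Int.card_Icc]
  have : ((Z:ℤ) + 1 - -(Z:ℤ)).toNat = 2*Z+1 := by omega
  rw [this]; ring

noncomputable def auxLat (X : ℕ) (a b : ℤ) (Z : ℕ) : Finset (ℤ × ℤ × ℤ) :=
  (auxBox Z).filter (fun s => s ≠ 0 ∧ (X:ℤ) ∣ a * s.1 + b * s.2.1 + s.2.2)

theorem aux_mem_lat (X : ℕ) (a b : ℤ) (Z : ℕ) (s : ℤ × ℤ × ℤ) :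
    s ∈ auxLat X a b Z ↔ (|s.1| ≤ Z ∧ |s.2.1| ≤ Z ∧ |s.2.2| ≤ Z) ∧ s ≠ 0 ∧
      (X:ℤ) ∣ a * s.1 + b * s.2.1 + s.2.2 := by
  rw [auxLat, Finset.mem_filter, aux_mem_box]

def auxDet (u v w : ℤ × ℤ × ℤ) : ℤ :=
  u.1 * (v.2.1 * w.2.2 - v.2.2 * w.2.1) + u.2.1 * (v.2.2 * w.1 - v.1 * w.2.2)
    + u.2.2 * (v.1 * w.2.1 - v.2.1 * w.1)

theorem aux_red_bound (d r1 r2 r3 u v w Z y : ℤ) (hd : d ≠ 0)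
    (h1 : 0 ≤ r1) (h1' : r1 < |d|) (h2 : 0 ≤ r2) (h2' : r2 < |d|) (h3 : 0 ≤ r3) (h3' : r3 < |d|)
    (hu : |u| ≤ Z) (hv : |v| ≤ Z) (hw : |w| ≤ Z) (h : d * y = r1 * u + r2 * v + r3 * w) :
    |y| ≤ 3 * Z := by
  have hdpos := abs_pos.mpr hd
  have : |d| * |y| ≤ |d| * (3 * Z) := by
    rw [← abs_mul, h]
    calc _ ≤ |r1 * u| + |r2 * v| + |r3 * w| := abs_add_three _ _ _
      _ = r1 * |u| + r2 * |v| + r3 * |w| := by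
        rw [abs_mul, abs_mul, abs_mul, abs_of_nonneg h1, abs_of_nonneg h2, abs_of_nonneg h3]
      _ ≤ |d| * Z + |d| * Z + |d| * Z := by gcongr
      _ = _ := by ring
  exact le_of_mul_le_mul_left this hdpos

theorem aux_rank3 (X : ℕ) (a b : ℤ) (Z : ℕ) (u v w : ℤ × ℤ × ℤ)
    (hu : u ∈ auxLat X a b Z) (hv : v ∈ auxLat X a b Z) (hw : w ∈ auxLat X a b Z)
    (hd : auxDet u v w ≠ 0) : (auxLat X a b Z).card * X ≤ (8*Z+1)^3 := by
  classical
  have hrep : ∀ c : ℤ, ∃ r : ℤ × ℤ × ℤ, (|r.1| ≤ 3*Z ∧ |r.2.1| ≤ 3*Z ∧ |r.2.2| ≤ 3*Z) ∧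
      (X:ℤ) ∣ a * r.1 + b * r.2.1 + r.2.2 - c := by
    intro c
    obtain ⟨u1, u2, u3⟩ := u
    obtain ⟨v1, v2, v3⟩ := v
    obtain ⟨w1, w2, w3⟩ := w
    rw [aux_mem_lat] at hu hv hw
    simp only [auxDet] at hd hu hv hw
    set d := u1 * (v2 * w3 - v3 * w2) + u2 * (v3 * w1 - v1 * w3) + u3 * (v1 * w2 - v2 * w1) with hdd
    set A := c * (v1 * w2 - v2 * w1) with hA
    set B := c * (w1 * u2 - w2 * u1) with hB
    set E := c * (u1 * v2 - u2 * v1) with hE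
    have a1 := Int.mul_ediv_add_emod A d
    have a2 := Int.mul_ediv_add_emod B d
    have a3 := Int.mul_ediv_add_emod E d
    have b1 := Int.emod_nonneg A hd
    have b2 := Int.emod_nonneg B hd
    have b3 := Int.emod_nonneg E hd
    have c1 := Int.emod_lt_abs A hd
    have c2 := Int.emod_lt_abs B hd
    have c3 := Int.emod_lt_abs E hd
    generalize A / d = q1 at *
    generalize B / d = q2 at *
    generalize E / d = q3 at *
    generalize A % d = r1 at *
    generalize B % d = r2 at *
    generalize E % d = r3 at *
    have e1 : r1 = A - d * q1 := by linarith
    have e2 : r2 = B - d * q2 := by linarith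
    have e3 : r3 = E - d * q3 := by linarith
    refine ⟨(-(q1*u1+q2*v1+q3*w1), -(q1*u2+q2*v2+q3*w2), c -(q1*u3+q2*v3+q3*w3)), ⟨?_, ?_, ?_⟩, ?_⟩
    · refine aux_red_bound d r1 r2 r3 u1 v1 w1 Z _ hd b1 c1 b2 c2 b3 c3 hu.1.1 hv.1.1 hw.1.1 ?_
      simp only [e1, e2, e3, hA, hB, hE, hdd]; ring
    · refine aux_red_bound d r1 r2 r3 u2 v2 w2 Z _ hd b1 c1 b2 c2 b3 c3 hu.1.2.1 hv.1.2.1 hw.1.2.1 ?_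
      simp only [e1, e2, e3, hA, hB, hE, hdd]; ring
    · refine aux_red_bound d r1 r2 r3 u3 v3 w3 Z _ hd b1 c1 b2 c2 b3 c3 hu.1.2.2 hv.1.2.2 hw.1.2.2 ?_
      simp only [e1, e2, e3, hA, hB, hE, hdd]; ring
    · obtain ⟨k1, hk1⟩ := hu.2.2
      obtain ⟨k2, hk2⟩ := hv.2.2
      obtain ⟨k3, hk3⟩ := hw.2.2
      refine ⟨-(q1*k1+q2*k2+q3*k3), ?_⟩
      linear_combination -q1 * hk1 - q2 * hk2 - q3 * hk3
  choose r hr1 hr2 using hrep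
  have hc : (auxLat X a b Z ×ˢ Finset.range X).card ≤ (auxBox (4*Z)).card := by
    apply Finset.card_le_card_of_injOn (fun sc => sc.1 + r (sc.2:ℕ))
    · rintro ⟨s, c⟩ hs
      simp only [Finset.coe_product, Set.mem_prod, Finset.mem_coe, aux_mem_lat] at hs
      simp only [Finset.mem_coe]
      rw [aux_mem_box]
      have h1 := hr1 (c:ℤ)
      have h2 := hs.1.1
      push_cast
      refine ⟨?_, ?_, ?_⟩
      · have := abs_add_le s.1 (r c).1
        simp only [Prod.fst_add]; linarith
      · have := abs_add_le s.2.1 (r c).2.1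
        simp only [Prod.fst_add, Prod.snd_add]; linarith
      · have := abs_add_le s.2.2 (r c).2.2
        simp only [Prod.snd_add]; linarith
    · rintro ⟨s, c⟩ hs ⟨s', c'⟩ hs' he
      simp only [Finset.coe_product, Set.mem_prod, Finset.mem_coe, aux_mem_lat,
        Finset.mem_range] at hs hs'
      simp only at he
      have hcc : c = c' := by
        obtain ⟨k1, hk1⟩ := hs.1.2.2
        obtain ⟨k2, hk2⟩ := hs'.1.2.2
        obtain ⟨k3, hk3⟩ := hr2 (c:ℤ)
        obtain ⟨k4, hk4⟩ := hr2 (c':ℤ)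
        have g1 := congrArg Prod.fst he
        have g2 := congrArg (fun z => z.2.1) he
        have g3 := congrArg (fun z => z.2.2) he
        simp only [Prod.fst_add, Prod.snd_add] at g1 g2 g3
        have hdv : (X:ℤ) ∣ (c':ℤ) - c := ⟨k1 + k3 - k2 - k4, by
          linear_combination -a * g1 - b * g2 - g3 + hk1 + hk3 - hk2 - hk4⟩
        have hm := (Nat.modEq_iff_dvd (n := X) (a := c) (b := c')).mpr hdv
        exact Nat.ModEq.eq_of_lt_of_lt hm hs.2 hs'.2
      subst hcc
      simpa using he
  rw [Finset.card_product, Finset.card_range, aux_card_box] at hc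
  calc _ ≤ _ := hc
    _ = _ := by ring

theorem aux_normal (S : Finset (ℤ × ℤ × ℤ))
    (h : ∀ u ∈ S, ∀ v ∈ S, ∀ w ∈ S, auxDet u v w = 0) :
    ∃ n1 n2 n3 : ℤ, ¬ (n1 = 0 ∧ n2 = 0 ∧ n3 = 0) ∧
      ∀ s ∈ S, n1 * s.1 + n2 * s.2.1 + n3 * s.2.2 = 0 := by
  by_cases hc : ∀ u ∈ S, ∀ v ∈ S, u.2.1 * v.2.2 - u.2.2 * v.2.1 = 0 ∧
      u.2.2 * v.1 - u.1 * v.2.2 = 0 ∧ u.1 * v.2.1 - u.2.1 * v.1 = 0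
  · by_cases h0 : ∀ u ∈ S, u = 0
    · refine ⟨1, 0, 0, by simp, fun s hs => ?_⟩
      rw [h0 s hs]; simp
    · push Not at h0
      obtain ⟨u, hu, hu0⟩ := h0
      by_cases h1 : u.1 = 0
      · by_cases h2 : u.2.1 = 0
        · have h3 : u.2.2 ≠ 0 := fun h3 => hu0 (by ext <;> simp [h1, h2, h3])
          refine ⟨u.2.2, 0, -u.1, by simp [h3], fun s hs => ?_⟩
          have := (hc u hu s hs).2.1
          linarith
        · refine ⟨-u.2.1, u.1, 0, by simp [h2], fun s hs => ?_⟩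
          have := (hc u hu s hs).2.2
          linarith
      · refine ⟨-u.2.1, u.1, 0, by simp [h1], fun s hs => ?_⟩
        have := (hc u hu s hs).2.2
        linarith
  · push Not at hc
    obtain ⟨u, hu, v, hv, huv⟩ := hc
    refine ⟨u.2.1 * v.2.2 - u.2.2 * v.2.1, u.2.2 * v.1 - u.1 * v.2.2, u.1 * v.2.1 - u.2.1 * v.1,
      fun hz => huv hz.1 hz.2.1 hz.2.2, fun s hs => ?_⟩
    have := h s hs u hu v hv
    simp only [auxDet] at this
    linarith

theorem aux_rank2 (S : Finset (ℤ × ℤ × ℤ)) (Z L : ℕ) (hL : 1 ≤ L) (hZ : L ≤ Z)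
    (h : ∀ u ∈ S, ∀ v ∈ S, ∀ w ∈ S, auxDet u v w = 0)
    (hb : ∀ s ∈ S, |s.1| ≤ Z ∧ |s.2.1| ≤ Z ∧ |s.2.2| ≤ Z)
    (hsep : ∀ s ∈ S, ∀ s' ∈ S, |s.1 - s'.1| < L → |s.2.1 - s'.2.1| < L →
      |s.2.2 - s'.2.2| < L → s = s') :
    S.card * L^2 ≤ 36 * Z^2 := by
  obtain ⟨n1, n2, n3, hn0, hn⟩ := aux_normal S h
  have hne : 0 < |n1| ∨ 0 < |n2| ∨ 0 < |n3| := by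
    simp only [abs_pos]; tauto
  by_cases c3 : |n1| ≤ |n3| ∧ |n2| ≤ |n3|
  · exact aux_cell2 S (fun s => s.1) (fun s => s.2.1) (fun s => s.2.2) Z L hL hZ
      (fun s hs => (hb s hs).1) (fun s hs => (hb s hs).2.1) n1 n2 n3
      (abs_pos.mp (by omega)) c3.1 c3.2 hn hsep
  · by_cases c2 : |n1| ≤ |n2| ∧ |n3| ≤ |n2|
    · exact aux_cell2 S (fun s => s.1) (fun s => s.2.2) (fun s => s.2.1) Z L hL hZ
        (fun s hs => (hb s hs).1) (fun s hs => (hb s hs).2.2) n1 n3 n2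
        (abs_pos.mp (by omega)) c2.1 c2.2 (fun s hs => by linarith [hn s hs])
        (fun s hs s' hs' h1 h2 h3 => hsep s hs s' hs' h1 h3 h2)
    · exact aux_cell2 S (fun s => s.2.1) (fun s => s.2.2) (fun s => s.1) Z L hL hZ
        (fun s hs => (hb s hs).2.1) (fun s hs => (hb s hs).2.2) n2 n3 n1
        (abs_pos.mp (by omega)) (by omega) (by omega) (fun s hs => by linarith [hn s hs])
        (fun s hs s' hs' h1 h2 h3 => hsep s hs s' hs' h3 h1 h2)

theorem aux_count (X : ℕ) (hX : 1 ≤ X) (a b : ℤ) (Z : ℕ) (hne : (auxLat X a b Z).Nonempty) :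
    ∃ L : ℕ, 1 ≤ L ∧ L ≤ Z ∧ L ≤ X ∧ (auxLat X a b L).Nonempty ∧
      ((auxLat X a b Z).card * L^2 ≤ 36 * Z^2 ∨ (auxLat X a b Z).card * X ≤ (8*Z+1)^3) := by
  classical
  have hex : ∃ L, (auxLat X a b L).Nonempty := ⟨Z, hne⟩
  have hspec := Nat.find_spec hex
  have hmin : ∀ m, m < Nat.find hex → ¬ (auxLat X a b m).Nonempty := fun m hm => Nat.find_min hex hm
  have hLZ : Nat.find hex ≤ Z := Nat.find_min' hex hne
  have hLX : Nat.find hex ≤ X := by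
    apply Nat.find_min' hex
    refine ⟨(0, 0, (X:ℤ)), ?_⟩
    rw [aux_mem_lat]
    refine ⟨by simp, ?_, by simp⟩
    simp; omega
  generalize Nat.find hex = L at *
  have hL1 : 1 ≤ L := by
    by_contra h0
    have h0 : L = 0 := by omega
    subst h0
    obtain ⟨s, hs⟩ := hspec
    rw [aux_mem_lat] at hs
    apply hs.2.1
    have := hs.1
    simp at this
    ext <;> simp [this]
  refine ⟨L, hL1, hLZ, hLX, hspec, ?_⟩
  by_cases hdet : ∀ u ∈ auxLat X a b Z, ∀ v ∈ auxLat X a b Z, ∀ w ∈ auxLat X a b Z,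
      auxDet u v w = 0
  · left
    refine aux_rank2 _ Z L hL1 hLZ hdet (fun s hs => ((aux_mem_lat _ _ _ _ _).mp hs).1) ?_
    intro s hs s' hs' h1 h2 h3
    by_contra hss
    apply hmin (L-1) (by omega)
    refine ⟨s - s', ?_⟩
    rw [aux_mem_lat] at hs hs' ⊢
    refine ⟨?_, sub_ne_zero.mpr hss, ?_⟩
    · simp only [Prod.fst_sub, Prod.snd_sub]
      omega
    · obtain ⟨k1, hk1⟩ := hs.2.2
      obtain ⟨k2, hk2⟩ := hs'.2.2
      simp only [Prod.fst_sub, Prod.snd_sub]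
      exact ⟨k1 - k2, by linear_combination hk1 - hk2⟩
  · right
    push Not at hdet
    obtain ⟨u, hu, v, hv, w, hw, hd⟩ := hdet
    exact aux_rank3 X a b Z u v w hu hv hw hd

theorem aux_card_le_X (X : ℕ) (A : Finset ℕ) (hA : ∀ a ∈ A, 1 ≤ a ∧ a < X) : A.card ≤ X := by
  calc A.card ≤ (Finset.range X).card := Finset.card_le_card (fun a ha => by
        simpa using (hA a ha).2)
    _ = X := by simp

noncomputable def auxE (X : ℕ) (A : Finset ℕ) (R : ℕ) : Finset (ℕ × ℕ) := by
  classical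
  exact (A ×ˢ A).filter (fun p => (auxLat X p.1 p.2 R).Nonempty)

theorem aux_mem_E (X : ℕ) (A : Finset ℕ) (R : ℕ) (p : ℕ × ℕ) :
    p ∈ auxE X A R ↔ (p.1 ∈ A ∧ p.2 ∈ A) ∧ (auxLat X p.1 p.2 R).Nonempty := by
  simp [auxE]

theorem aux_k_bound (X R a b : ℕ) (ha : a ≤ X) (hb : b ≤ X) (hX : 1 ≤ X) (x y t k : ℤ)
    (hx : |x| ≤ R) (hy : |y| ≤ R) (ht : |t| ≤ R) (h : (a:ℤ) * x + b * y + t = X * k) :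
    |k| ≤ 3 * R := by
  have hXp : (0:ℤ) < X := by exact_mod_cast hX
  have : (X:ℤ) * |k| ≤ X * (3 * R) := by
    have e : (X:ℤ) * |k| = |(a:ℤ) * x + b * y + t| := by
      rw [h, abs_mul, abs_of_pos hXp]
    rw [e]
    calc _ ≤ |(a:ℤ) * x| + |(b:ℤ) * y| + |t| := abs_add_three _ _ _
      _ = (a:ℤ) * |x| + (b:ℤ) * |y| + |t| := by rw [abs_mul, abs_mul, Nat.abs_cast, Nat.abs_cast]
      _ ≤ (X:ℤ) * R + X * R + X * R := by
        have h1 : (a:ℤ) ≤ X := by exact_mod_cast ha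
        have h2 : (b:ℤ) ≤ X := by exact_mod_cast hb
        have h3 : |t| ≤ X * R := by nlinarith [abs_nonneg t]
        gcongr
      _ = _ := by ring
  exact le_of_mul_le_mul_left this hXp

theorem aux_E_card (X : ℕ) (hX : 1 ≤ X) (A : Finset ℕ) (hA : ∀ a ∈ A, 1 ≤ a ∧ a < X)
    (R : ℕ) (hR : 1 ≤ R) : (auxE X A R).card ≤ 378 * A.card * R^4 := by
  classical
  by_cases hRX : X ≤ R
  · have h1 : (auxE X A R).card ≤ A.card * A.card := by
      rw [← Finset.card_product]
      apply Finset.card_le_card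
      intro p hp
      rw [aux_mem_E] at hp
      exact Finset.mem_product.mpr hp.1
    have h2 : A.card ≤ R := (aux_card_le_X X A hA).trans hRX
    have h3 : R ≤ R^4 := Nat.le_self_pow (by norm_num) R
    calc _ ≤ _ := h1
      _ ≤ A.card * R^4 := by gcongr; omega
      _ ≤ _ := by rw [mul_assoc]; omega
  · push Not at hRX
    set D := A ×ˢ auxBox R ×ˢ Finset.Icc (-(3*R:ℤ)) (3*R) with hD
    let f : ℕ × (ℤ × ℤ × ℤ) × ℤ → ℕ × ℕ := fun q =>
      (q.1, ((X * q.2.2 - q.1 * q.2.1.1 - q.2.1.2.2) / q.2.1.2.1).toNat)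
    let g : ℕ × (ℤ × ℤ × ℤ) × ℤ → ℕ × ℕ := fun q =>
      (((X * q.2.2 - q.1 * q.2.1.2.1 - q.2.1.2.2) / q.2.1.1).toNat, q.1)
    have hsub : auxE X A R ⊆ D.image f ∪ D.image g := by
      rintro ⟨a, b⟩ hp
      rw [aux_mem_E] at hp
      obtain ⟨⟨ha, hb⟩, ⟨⟨x, y, t⟩, hs⟩⟩ := hp
      rw [aux_mem_lat] at hs
      obtain ⟨hbd, hne, ⟨k, hk⟩⟩ := hs
      simp only at hbd hk ha hb
      have hkb := aux_k_bound X R a b (hA a ha).2.le (hA b hb).2.le hX x y t k hbd.1 hbd.2.1 hbd.2.2 hk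
      have hkm : k ∈ Finset.Icc (-(3*R:ℤ)) (3*R) := by
        rw [Finset.mem_Icc]; exact abs_le.mp hkb
      have hbm : (x, y, t) ∈ auxBox R := by rw [aux_mem_box]; exact hbd
      rw [Finset.mem_union, Finset.mem_image, Finset.mem_image]
      by_cases hy : y = 0
      · by_cases hx : x = 0
        · exfalso
          subst hx; subst hy
          have ht : t = 0 := by
            apply Int.eq_zero_of_abs_lt_dvd (m := (X:ℤ)) ⟨k, by linarith⟩
            have : (R:ℤ) < X := by exact_mod_cast hRX
            linarith [hbd.2.2]
          exact hne (by rw [ht]; rfl)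
        · right
          refine ⟨(b, (x, y, t), k), ?_, ?_⟩
          · simp only [hD, Finset.mem_product]; exact ⟨hb, hbm, hkm⟩
          · simp only [g, Prod.mk.injEq, and_true]
            have : (X:ℤ) * k - b * y - t = a * x := by linarith
            rw [this, Int.mul_ediv_cancel _ hx]; simp
      · left
        refine ⟨(a, (x, y, t), k), ?_, ?_⟩
        · simp only [hD, Finset.mem_product]; exact ⟨ha, hbm, hkm⟩
        · simp only [f, Prod.mk.injEq, true_and]
          have : (X:ℤ) * k - a * x - t = b * y := by linarith
          rw [this, Int.mul_ediv_cancel _ hy]; simp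
    have hDc : D.card = A.card * ((2*R+1)^3 * (6*R+1)) := by
      simp only [hD, Finset.card_product, aux_card_box, Int.card_Icc]
      congr 2; omega
    have h1 : (2*R+1)^3 * (6*R+1) ≤ (3*R)^3 * (7*R) := by gcongr <;> omega
    calc _ ≤ _ := Finset.card_le_card hsub
      _ ≤ (D.image f).card + (D.image g).card := Finset.card_union_le _ _
      _ ≤ D.card + D.card := add_le_add Finset.card_image_le Finset.card_image_le
      _ = 2 * (A.card * ((2*R+1)^3 * (6*R+1))) := by rw [hDc]; ring
      _ ≤ 2 * (A.card * ((3*R)^3 * (7*R))) := by gcongr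
      _ = _ := by ring

theorem aux_E_card2 (X : ℕ) (hX : 1 ≤ X) (A : Finset ℕ) (hA : ∀ a ∈ A, 1 ≤ a ∧ a < X)
    (j : ℕ) : ((auxE X A (2^(j+1))).card : ℝ) ≤ 78 * (A.card : ℝ)^((3:ℝ)/2) * 4^j := by
  have h1 : ((auxE X A (2^(j+1))).card : ℝ) ≤ 6048 * A.card * 16^j := by
    have := aux_E_card X hX A hA (2^(j+1)) Nat.one_le_two_pow
    have h : ((auxE X A (2^(j+1))).card : ℝ) ≤ 378 * A.card * ((2:ℝ)^(j+1))^4 := by exact_mod_cast this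
    have e : ((2:ℝ)^(j+1))^4 = 16 * 16^j := by
      rw [← pow_mul, mul_comm, pow_mul]; norm_num; ring
    rw [e] at h; linarith
  have h2 : ((auxE X A (2^(j+1))).card : ℝ) ≤ (A.card : ℝ)^2 := by
    have : (auxE X A (2^(j+1))).card ≤ A.card * A.card := by
      rw [← Finset.card_product]
      apply Finset.card_le_card
      intro p hp
      rw [aux_mem_E] at hp
      exact Finset.mem_product.mpr hp.1
    rw [sq]; exact_mod_cast this
  set e : ℝ := ((auxE X A (2^(j+1))).card : ℝ) with he
  have he0 : 0 ≤ e := by positivity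
  apply (sq_le_sq₀ he0 (by positivity)).mp
  have e3 : ((A.card : ℝ)^((3:ℝ)/2))^2 = (A.card:ℝ)^3 := by
    rw [← Real.rpow_natCast, ← Real.rpow_mul (by positivity)]; norm_num
  have e4 : ((4:ℝ)^j)^2 = 16^j := by rw [← pow_mul, mul_comm, pow_mul]; norm_num
  calc e^2 = e * e := sq e
    _ ≤ (6048 * A.card * 16^j) * (A.card : ℝ)^2 := by gcongr
    _ = 6048 * (A.card:ℝ)^3 * 16^j := by ring
    _ ≤ 6084 * (A.card:ℝ)^3 * 16^j := by gcongr; norm_num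
    _ = (78 * (A.card : ℝ)^((3:ℝ)/2) * 4^j)^2 := by rw [mul_pow, mul_pow, e3, e4]; norm_num

theorem aux_I (X : ℕ) (hX : 1 ≤ X) (A : Finset ℕ) (hA : ∀ a ∈ A, 1 ≤ a ∧ a < X)
    (Z : ℕ) (hZ : 1 ≤ Z) :
    ∑ p ∈ A ×ˢ A, ((auxLat X p.1 p.2 Z).card : ℝ) ≤
      2808 * ((Nat.log 2 X : ℝ) + 1) * (A.card : ℝ)^((3:ℝ)/2) * Z^2 +
        729 * (A.card : ℝ)^2 * Z^3 / X := by
  classical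
  have hXp : (0:ℝ) < X := by exact_mod_cast hX
  have hpt : ∀ p ∈ A ×ˢ A, ((auxLat X p.1 p.2 Z).card : ℝ) ≤
      (∑ j ∈ Finset.range (Nat.log 2 X + 1),
        if p ∈ auxE X A (2^(j+1)) then 36 * (Z:ℝ)^2 / 4^j else 0) + 729 * (Z:ℝ)^3 / X := by
    intro p hp
    have hnn : ∀ j ∈ Finset.range (Nat.log 2 X + 1),
        0 ≤ (if p ∈ auxE X A (2^(j+1)) then 36 * (Z:ℝ)^2 / 4^j else 0) := by
      intro j _; split_ifs <;> positivity
    have hs0 := Finset.sum_nonneg hnn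
    by_cases hne : (auxLat X p.1 p.2 Z).Nonempty
    · obtain ⟨L, hL1, hLZ, hLX, hLne, hor⟩ := aux_count X hX p.1 p.2 Z hne
      rcases hor with h | h
      · have hj : Nat.log 2 L ∈ Finset.range (Nat.log 2 X + 1) := by
          rw [Finset.mem_range]
          have := Nat.log_mono_right (b := 2) hLX
          omega
        have hmem : p ∈ auxE X A (2^(Nat.log 2 L + 1)) := by
          rw [aux_mem_E]
          refine ⟨Finset.mem_product.mp hp, ?_⟩
          obtain ⟨s, hs⟩ := hLne
          refine ⟨s, ?_⟩
          rw [aux_mem_lat] at hs ⊢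
          have hlt : (L:ℤ) ≤ (2^(Nat.log 2 L + 1) : ℕ) := by
            exact_mod_cast (Nat.lt_pow_succ_log_self (by norm_num) L).le
          exact ⟨⟨hs.1.1.trans hlt, hs.1.2.1.trans hlt, hs.1.2.2.trans hlt⟩, hs.2⟩
        have hle := Finset.single_le_sum hnn hj
        rw [if_pos hmem] at hle
        have hpow : (4:ℝ)^(Nat.log 2 L) ≤ (L:ℝ)^2 := by
          have : 2^(Nat.log 2 L) ≤ L := Nat.pow_log_le_self 2 (by omega)
          have h2 : ((2:ℝ)^(Nat.log 2 L)) ≤ L := by exact_mod_cast this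
          calc (4:ℝ)^(Nat.log 2 L) = ((2:ℝ)^(Nat.log 2 L))^2 := by
                rw [← pow_mul, mul_comm, pow_mul]; norm_num
            _ ≤ _ := by gcongr
        have hc : ((auxLat X p.1 p.2 Z).card : ℝ) ≤ 36 * (Z:ℝ)^2 / 4^(Nat.log 2 L) := by
          rw [le_div_iff₀ (by positivity)]
          calc _ ≤ ((auxLat X p.1 p.2 Z).card : ℝ) * (L:ℝ)^2 := by gcongr
            _ ≤ _ := by exact_mod_cast h
        have : 0 ≤ 729 * (Z:ℝ)^3 / X := by positivity
        linarith
      · have hc : ((auxLat X p.1 p.2 Z).card : ℝ) ≤ 729 * (Z:ℝ)^3 / X := by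
          rw [le_div_iff₀ hXp]
          have h9 : (8*Z+1)^3 ≤ 729 * Z^3 := by
            calc (8*Z+1)^3 ≤ (9*Z)^3 := by gcongr; omega
              _ = _ := by ring
          exact_mod_cast h.trans h9
        linarith
    · rw [Finset.not_nonempty_iff_eq_empty] at hne
      rw [hne]
      simp only [Finset.card_empty, Nat.cast_zero]
      positivity
  calc _ ≤ ∑ p ∈ A ×ˢ A, ((∑ j ∈ Finset.range (Nat.log 2 X + 1),
        if p ∈ auxE X A (2^(j+1)) then 36 * (Z:ℝ)^2 / 4^j else 0) + 729 * (Z:ℝ)^3 / X) :=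
        Finset.sum_le_sum hpt
    _ = (∑ j ∈ Finset.range (Nat.log 2 X + 1), ∑ p ∈ A ×ˢ A,
        if p ∈ auxE X A (2^(j+1)) then 36 * (Z:ℝ)^2 / 4^j else 0) +
          (A.card:ℝ)^2 * (729 * (Z:ℝ)^3 / X) := by
        rw [Finset.sum_add_distrib, Finset.sum_comm]
        congr 1
        rw [Finset.sum_const, Finset.card_product, nsmul_eq_mul]; push_cast; ring
    _ ≤ (∑ j ∈ Finset.range (Nat.log 2 X + 1), 2808 * (A.card : ℝ)^((3:ℝ)/2) * Z^2) +
          (A.card:ℝ)^2 * (729 * (Z:ℝ)^3 / X) := by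
        gcongr with j hj
        rw [← Finset.sum_filter, Finset.sum_const, nsmul_eq_mul]
        have hcle : (((A ×ˢ A).filter (fun p => p ∈ auxE X A (2^(j+1)))).card : ℝ) ≤
            78 * (A.card : ℝ)^((3:ℝ)/2) * 4^j := by
          refine le_trans ?_ (aux_E_card2 X hX A hA j)
          exact_mod_cast Finset.card_le_card (fun p hp => (Finset.mem_filter.mp hp).2)
        calc _ ≤ (78 * (A.card : ℝ)^((3:ℝ)/2) * 4^j) * (36 * (Z:ℝ)^2 / 4^j) := by gcongr
          _ = _ := by field_simp; ring
    _ = _ := by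
        rw [Finset.sum_const, Finset.card_range, nsmul_eq_mul]; push_cast; ring

def auxEdge (X W : ℕ) (a b : ℕ) : Prop := ∃ v₁ v₂ v₃ v₄ : ℤ, 0 < v₁ ∧ v₂ ≠ 0 ∧
  |v₁| ≤ W ∧ |v₂| ≤ W ∧ |v₃| ≤ W ∧ |v₄| ≤ W ∧ v₁ * a + v₂ * b + v₃ * X + v₄ = 0

noncomputable def auxDv (X n : ℕ) : Finset ℕ := if n ≤ X^2 then n.divisors else ∅

theorem aux_mem_dv (X n d : ℕ) (h : d ∣ n) (hn : n ≠ 0) (hX : n ≤ X^2) : d ∈ auxDv X n := by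
  rw [auxDv, if_pos hX]; exact Nat.mem_divisors.mpr ⟨h, hn⟩

theorem aux_card_dv (X D : ℕ) (hD : ∀ n, 1 ≤ n → n ≤ X^2 → n.divisors.card ≤ D) (n : ℕ) :
    (auxDv X n).card ≤ D := by
  rw [auxDv]
  split_ifs with h
  · rcases Nat.eq_zero_or_pos n with h0 | h0
    · subst h0; simp
    · exact hD n h0 h
  · simp

noncomputable def auxPr (i p q W : ℕ) (γ : ℤ) : Finset ℤ := by
  classical
  exact (Finset.Icc (-(W:ℤ)) W).filter (fun v =>
    (Nat.Coprime p q ∧ 2^i ≤ max p q ∧ p ≤ W ∧ q ≤ W ∧ 0 < p ∧ 0 < q) ∧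
      ∃ w : ℤ, |w| ≤ W ∧ (q:ℤ) * v - p * w = γ)

theorem aux_mem_pr (i p q W : ℕ) (γ v : ℤ) : v ∈ auxPr i p q W γ ↔ |v| ≤ W ∧
    (Nat.Coprime p q ∧ 2^i ≤ max p q ∧ p ≤ W ∧ q ≤ W ∧ 0 < p ∧ 0 < q) ∧
      ∃ w : ℤ, |w| ≤ W ∧ (q:ℤ) * v - p * w = γ := by
  unfold auxPr
  simp only [Finset.mem_filter, Finset.mem_Icc, abs_le]

theorem aux_card_pr (i p q W : ℕ) (γ : ℤ) : (auxPr i p q W γ).card ≤ 4 * W / 2^i := by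
  classical
  rcases (auxPr i p q W γ).eq_empty_or_nonempty with h0 | ⟨v0, hv0⟩
  · rw [h0]; simp
  · rw [aux_mem_pr] at hv0
    obtain ⟨-, ⟨hcop, hmax, hpW, hqW, hp, hq⟩, -⟩ := hv0
    rw [Nat.le_div_iff_mul_le (by positivity)]
    have hp0 : (p:ℤ) ≠ 0 := by positivity
    have hq0 : (q:ℤ) ≠ 0 := by positivity
    have hcz : IsCoprime (p:ℤ) (q:ℤ) := Nat.isCoprime_iff_coprime.mpr hcop
    have hex : ∀ v : ℤ, ∃ w : ℤ, v ∈ auxPr i p q W γ → |w| ≤ W ∧ (q:ℤ) * v - p * w = γ := by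
      intro v
      by_cases hv : v ∈ auxPr i p q W γ
      · obtain ⟨w, hw⟩ := ((aux_mem_pr _ _ _ _ _ _).mp hv).2.2
        exact ⟨w, fun _ => hw⟩
      · exact ⟨0, fun h => absurd h hv⟩
    choose w hw using hex
    rcases le_total q p with hpq | hpq
    · rw [max_eq_left hpq] at hmax
      refine le_trans (Nat.mul_le_mul_left _ hmax) ?_
      refine aux_cell1 _ (fun v => v) W p hp hpW (fun v hv => ((aux_mem_pr _ _ _ _ _ _).mp hv).1) ?_
      intro v hv v' hv' hlt
      have e : (q:ℤ) * (v - v') = p * (w v - w v') := by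
        linarith [(hw v hv).2, (hw v' hv').2]
      have hd : (p:ℤ) ∣ v - v' := hcz.dvd_of_dvd_mul_left ⟨_, e⟩
      have := Int.eq_zero_of_abs_lt_dvd hd hlt
      linarith
    · rw [max_eq_right hpq] at hmax
      refine le_trans (Nat.mul_le_mul_left _ hmax) ?_
      refine aux_cell1 _ w W q hq hqW (fun v hv => (hw v hv).1) ?_
      intro v hv v' hv' hlt
      have e : (p:ℤ) * (w v - w v') = q * (v - v') := by
        linarith [(hw v hv).2, (hw v' hv').2]
      have hd : (q:ℤ) ∣ w v - w v' := hcz.symm.dvd_of_dvd_mul_left ⟨_, e⟩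
      have h0 := Int.eq_zero_of_abs_lt_dvd hd hlt
      rw [h0, mul_zero] at e
      have := (mul_eq_zero.mp e.symm).resolve_left hq0
      linarith

theorem aux_common (X W D : ℕ) (hX : 1 ≤ X) (hWX : W ≤ X)
    (hD : ∀ n, 1 ≤ n → n ≤ X^2 → n.divisors.card ≤ D) (b b' : ℕ) (N : Finset ℕ)
    (hN : ∀ a ∈ N, 1 ≤ a ∧ a < X ∧ auxEdge X W a b ∧ auxEdge X W a b') :
    N.card ≤ ∑ i ∈ Finset.range (Nat.log 2 W + 1),
      (auxLat X b b' (2^(i+2)*W)).card * (D * (D * ((4*W/2^i) * ((4*W/2^i) * D)))) := by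
  classical
  have hsub : N ⊆ (Finset.range (Nat.log 2 W + 1)).biUnion fun i =>
      (auxLat X b b' (2^(i+2)*W)).biUnion fun s =>
      (auxDv X s.1.natAbs).biUnion fun q =>
      (auxDv X s.2.1.natAbs).biUnion fun p =>
      (auxPr i p q W (-((b * s.1 + b' * s.2.1 + s.2.2) / (X:ℤ)))).biUnion fun v3 =>
      (auxPr i p q W s.2.2).biUnion fun v4 =>
      auxDv X (s.1 / (q:ℤ) * b + v3 * X + v4).natAbs := by
    intro a ha
    obtain ⟨ha1, haX, ⟨v1, v2, v3, v4, hv1, hv2, bv1, bv2, bv3, bv4, ev⟩,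
      ⟨w1, w2, w3, w4, hw1, hw2, bw1, bw2, bw3, bw4, ew⟩⟩ := hN a ha
    lift v1 to ℕ using hv1.le
    lift w1 to ℕ using hw1.le
    have hv1' : 0 < v1 := by exact_mod_cast hv1
    have hw1' : 0 < w1 := by exact_mod_cast hw1
    have bv1' : v1 ≤ W := by simpa using bv1
    have bw1' : w1 ≤ W := by simpa using bw1
    obtain ⟨p, q, hcop, hvp, hwq⟩ := Nat.exists_coprime v1 w1
    have hg : 0 < Nat.gcd v1 w1 := Nat.gcd_pos_of_pos_left _ hv1'
    generalize Nat.gcd v1 w1 = g at *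
    subst hvp; subst hwq
    have hp : 0 < p := Nat.pos_of_mul_pos_right hv1'
    have hq : 0 < q := Nat.pos_of_mul_pos_right hw1'
    have hpW : p ≤ W := (Nat.le_mul_of_pos_right p hg).trans bv1'
    have hqW : q ≤ W := (Nat.le_mul_of_pos_right q hg).trans bw1'
    have hX0 : (X:ℤ) ≠ 0 := by positivity
    have hq0 : (q:ℤ) ≠ 0 := by positivity
    have hp0 : (p:ℤ) ≠ 0 := by positivity
    have hg0 : (g:ℤ) ≠ 0 := by positivity
    push_cast at ev ew
    have hmain : (b:ℤ) * (q * v2) + b' * (-(p * w2)) + (q * v4 - p * w4) =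
        X * (-(q * v3 - p * w3)) := by
      linear_combination (q:ℤ) * ev - (p:ℤ) * ew
    set P := max p q with hP
    have hPW : P ≤ W := max_le hpW hqW
    have hP1 : 1 ≤ P := le_max_of_le_left hp
    set i := Nat.log 2 P with hi
    have hi1 : 2^i ≤ P := Nat.pow_log_le_self 2 (by omega)
    have hi2 : P < 2^(i+1) := Nat.lt_pow_succ_log_self (by norm_num) P
    have hpP : p ≤ P := le_max_left _ _
    have hqP : q ≤ P := le_max_right _ _
    have hb1 : ∀ (c : ℕ) (z : ℤ), c ≤ P → |z| ≤ W → |(c:ℤ) * z| ≤ 2^(i+1) * W := by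
      intro c z hc hz
      rw [abs_mul, Nat.abs_cast]
      have : (c:ℤ) ≤ 2^(i+1) := by exact_mod_cast hc.trans hi2.le
      gcongr
    have hnat : ∀ (c : ℕ) (z : ℤ), c ≤ W → |z| ≤ W → ((c:ℤ) * z).natAbs ≤ X^2 := by
      intro c z hc hz
      rw [Int.natAbs_mul, Int.natAbs_natCast, sq]
      have : z.natAbs ≤ W := by rw [Int.abs_eq_natAbs] at hz; exact_mod_cast hz
      exact Nat.mul_le_mul (hc.trans hWX) (this.trans hWX)
    simp only [Finset.mem_biUnion]
    refine ⟨i, ?_, (q * v2, -(p * w2), q * v4 - p * w4), ?_, q, ?_, p, ?_, v3, ?_, v4, ?_, ?_⟩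
    · rw [Finset.mem_range]
      have := Nat.log_mono_right (b := 2) hPW
      omega
    · rw [aux_mem_lat]
      have hpw : ((2^(i+2) * W : ℕ) : ℤ) = 2^(i+1) * W + 2^(i+1) * W := by
        push_cast; ring
      have hnn : (0:ℤ) ≤ 2^(i+1) * W := by positivity
      refine ⟨?_, ?_, ?_⟩
      · rw [hpw]
        simp only
        refine ⟨?_, ?_, ?_⟩
        · linarith [hb1 q v2 hqP bv2]
        · rw [abs_neg]; linarith [hb1 p w2 hpP bw2]
        · linarith [hb1 q v4 hqP bv4, hb1 p w4 hpP bw4, abs_sub (q * v4) (p * w4)]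
      · intro h
        have := congrArg Prod.fst h
        simp [hv2] at this
        omega
      · exact ⟨_, hmain⟩
    · refine aux_mem_dv _ _ _ ?_ ?_ (hnat q v2 hqW bv2)
      · simp [Int.natAbs_mul]
      · simp [hv2]
        omega
    · simp only [Int.natAbs_neg]
      refine aux_mem_dv _ _ _ ?_ ?_ (hnat p w2 hpW bw2)
      · simp [Int.natAbs_mul]
      · simp [hw2]
        omega
    · rw [aux_mem_pr]
      refine ⟨bv3, ⟨hcop, hi1, hpW, hqW, hp, hq⟩, w3, bw3, ?_⟩
      simp only
      rw [hmain, Int.mul_ediv_cancel_left _ hX0]; ring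
    · rw [aux_mem_pr]
      exact ⟨bv4, ⟨hcop, hi1, hpW, hqW, hp, hq⟩, w4, bw4, rfl⟩
    · simp only
      rw [Int.mul_ediv_cancel_left _ hq0]
      have e : v2 * b + v3 * X + v4 = -((p * g * a : ℕ) : ℤ) := by
        push_cast; linarith
      rw [e, Int.natAbs_neg, Int.natAbs_natCast]
      refine aux_mem_dv _ _ _ (Dvd.intro_left _ rfl) (by positivity) ?_
      rw [sq]
      exact Nat.mul_le_mul (bv1'.trans hWX) haX.le
  refine (Finset.card_le_card hsub).trans ?_
  refine Finset.card_biUnion_le.trans ?_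
  refine Finset.sum_le_sum fun i _ => ?_
  refine Finset.card_biUnion_le_card_mul _ _ _ fun s _ => ?_
  refine (Finset.card_biUnion_le_card_mul _ _ (D * ((4*W/2^i) * ((4*W/2^i) * D))) fun q _ => ?_).trans
    (Nat.mul_le_mul_right _ (aux_card_dv X D hD _))
  refine (Finset.card_biUnion_le_card_mul _ _ ((4*W/2^i) * ((4*W/2^i) * D)) fun p _ => ?_).trans
    (Nat.mul_le_mul_right _ (aux_card_dv X D hD _))
  refine (Finset.card_biUnion_le_card_mul _ _ ((4*W/2^i) * D) fun v3 _ => ?_).trans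
    (Nat.mul_le_mul_right _ (aux_card_pr _ _ _ _ _))
  refine (Finset.card_biUnion_le_card_mul _ _ D fun v4 _ => ?_).trans
    (Nat.mul_le_mul_right _ (aux_card_pr _ _ _ _ _))
  exact aux_card_dv X D hD _

theorem aux_H (X W D : ℕ) (hX : 1 ≤ X) (hW : 1 ≤ W) (hWX : W ≤ X)
    (hD : ∀ n, 1 ≤ n → n ≤ X^2 → n.divisors.card ≤ D) (hlog : Nat.log 2 X + 1 ≤ D)
    (A : Finset ℕ) (hA : ∀ a ∈ A, 1 ≤ a ∧ a < X) (H : Finset (ℕ × ℕ))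
    (hH : ∀ p ∈ H, p.1 ∈ A ∧ p.2 ∈ A ∧ auxEdge X W p.1 p.2) :
    (H.card : ℝ)^2 ≤ A.card * (750000 * (D:ℝ)^5 * ((A.card:ℝ)^((3:ℝ)/2) * W^4 +
      (A.card:ℝ)^2 * W^6 / X)) := by
  classical
  have hXp : (0:ℝ) < X := by exact_mod_cast hX
  have hlogR : (Nat.log 2 X : ℝ) + 1 ≤ D := by exact_mod_cast hlog
  have hlogW : (Nat.log 2 W : ℝ) + 1 ≤ D := by
    have : Nat.log 2 W ≤ Nat.log 2 X := Nat.log_mono_right hWX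
    have : Nat.log 2 W + 1 ≤ D := by omega
    exact_mod_cast this
  have hD1 : (1:ℝ) ≤ D := by
    have : 1 ≤ D := by omega
    exact_mod_cast this
  let d : ℕ → ℕ := fun a => (A.filter (fun b => (a, b) ∈ H)).card
  have h1 : H.card = ∑ a ∈ A, d a := by
    have hH2 : H = A.biUnion (fun a => (A.filter (fun b => (a, b) ∈ H)).image (fun b => (a, b))) := by
      ext ⟨x, y⟩
      simp only [Finset.mem_biUnion, Finset.mem_image, Finset.mem_filter, Prod.mk.injEq]
      constructor
      · intro h
        exact ⟨x, (hH _ h).1, y, ⟨(hH _ h).2.1, h⟩, rfl, rfl⟩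
      · rintro ⟨a, _, b, ⟨_, h⟩, rfl, rfl⟩
        exact h
    conv_lhs => rw [hH2]
    rw [Finset.card_biUnion]
    · refine Finset.sum_congr rfl fun a _ => ?_
      exact Finset.card_image_of_injective _ (fun b b' h => (Prod.mk.inj h).2)
    · intro a _ a' _ hne
      rw [Function.onFun, Finset.disjoint_left]
      rintro ⟨x, y⟩ h h'
      simp only [Finset.mem_image, Prod.mk.injEq] at h h'
      obtain ⟨_, _, h, _⟩ := h
      obtain ⟨_, _, h', _⟩ := h'
      exact hne (h.trans h'.symm)
  have h2 : ∑ a ∈ A, (d a)^2 = ∑ p ∈ A ×ˢ A, (A.filter (fun a => (a, p.1) ∈ H ∧ (a, p.2) ∈ H)).card := by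
    have e1 : ∀ a, (d a)^2 = ∑ p ∈ A ×ˢ A, if ((a, p.1) ∈ H ∧ (a, p.2) ∈ H) then 1 else 0 := by
      intro a
      rw [← Finset.card_filter, sq, ← Finset.card_product]
      congr 1
      ext ⟨x, y⟩
      simp only [Finset.mem_product, Finset.mem_filter]
      tauto
    simp_rw [e1]
    rw [Finset.sum_comm]
    refine Finset.sum_congr rfl fun p _ => ?_
    rw [Finset.card_filter]
  have h3 : (H.card:ℝ)^2 ≤ A.card * ∑ a ∈ A, ((d a : ℝ))^2 := by
    rw [h1]; push_cast
    exact sq_sum_le_card_mul_sum_sq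
  refine h3.trans ?_
  gcongr
  have h4 : ∑ a ∈ A, ((d a : ℝ))^2 ≤ ∑ p ∈ A ×ˢ A, ∑ i ∈ Finset.range (Nat.log 2 W + 1),
      ((auxLat X p.1 p.2 (2^(i+2)*W)).card : ℝ) * ((D:ℝ)^3 * (16 * (W:ℝ)^2 / 4^i)) := by
    have : ∑ a ∈ A, ((d a : ℝ))^2 = ((∑ a ∈ A, (d a)^2 : ℕ) : ℝ) := by push_cast; rfl
    rw [this, h2]
    push_cast
    refine Finset.sum_le_sum fun p _ => ?_
    have hc := aux_common X W D hX hWX hD p.1 p.2 (A.filter (fun a => (a, p.1) ∈ H ∧ (a, p.2) ∈ H)) (by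
      intro a ha
      rw [Finset.mem_filter] at ha
      exact ⟨(hA a ha.1).1, (hA a ha.1).2, (hH _ ha.2.1).2.2, (hH _ ha.2.2).2.2⟩)
    have hc' := (Nat.cast_le (α := ℝ)).mpr hc
    refine hc'.trans ?_
    push_cast
    refine Finset.sum_le_sum fun i _ => ?_
    refine mul_le_mul_of_nonneg_left ?_ (by positivity)
    have hk : ((4*W/2^i : ℕ) : ℝ) ≤ 4 * W / 2^i := by
      have := @Nat.cast_div_le ℝ _ _ _ (4*W) (2^i)
      push_cast at this
      exact this
    have e4 : (4:ℝ)^i = 2^i * 2^i := by rw [← mul_pow]; norm_num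
    calc _ ≤ (D:ℝ) * (D * ((4 * W / 2^i) * ((4 * W / 2^i) * D))) := by gcongr
      _ = _ := by rw [e4]; field_simp; ring
  refine h4.trans ?_
  rw [Finset.sum_comm]
  have h5 : ∀ i ∈ Finset.range (Nat.log 2 W + 1),
      ∑ p ∈ A ×ˢ A, ((auxLat X p.1 p.2 (2^(i+2)*W)).card : ℝ) * ((D:ℝ)^3 * (16 * (W:ℝ)^2 / 4^i))
      ≤ 750000 * (D:ℝ)^4 * ((A.card:ℝ)^((3:ℝ)/2) * W^4 + (A.card:ℝ)^2 * W^6 / X) := by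
    intro i hi
    rw [← Finset.sum_mul]
    have hI := aux_I X hX A hA (2^(i+2)*W) (Nat.mul_pos (by positivity) hW)
    have hiW : (2:ℝ)^i ≤ W := by
      rw [Finset.mem_range] at hi
      have : 2^i ≤ W := (Nat.pow_le_pow_right (by norm_num) (by omega)).trans
        (Nat.pow_log_le_self 2 (by omega))
      exact_mod_cast this
    have e4 : (4:ℝ)^i = 2^i * 2^i := by rw [← mul_pow]; norm_num
    push_cast at hI
    have hN3 : 0 ≤ (A.card:ℝ)^((3:ℝ)/2) := by positivity
    generalize (A.card:ℝ)^((3:ℝ)/2) = N3 at *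
    generalize (A.card:ℝ) = n at *
    have hD0 : (0:ℝ) ≤ D := by positivity
    have hW0 : (0:ℝ) ≤ W := by positivity
    calc _ ≤ (2808 * ((Nat.log 2 X : ℝ) + 1) * N3 * (2^(i+2) * (W:ℝ))^2 +
          729 * n^2 * (2^(i+2) * (W:ℝ))^3 / X) * ((D:ℝ)^3 * (16 * (W:ℝ)^2 / 4^i)) := by
          refine mul_le_mul_of_nonneg_right hI (by positivity)
      _ ≤ (2808 * (D:ℝ) * N3 * (2^(i+2) * (W:ℝ))^2 +
          729 * n^2 * (2^(i+2) * (W:ℝ))^3 / X) * ((D:ℝ)^3 * (16 * (W:ℝ)^2 / 4^i)) := by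
          gcongr
      _ = (D:ℝ)^3 * (718848 * D * (N3 * W^4) + 746496 * 1 * (n^2 * (2^i * (W:ℝ)^5) / X)) := by
          rw [e4, pow_add]; field_simp; ring
      _ ≤ (D:ℝ)^3 * (750000 * D * (N3 * W^4) + 750000 * D * (n^2 * (W * (W:ℝ)^5) / X)) := by
          gcongr <;> norm_num
      _ = _ := by ring
  calc _ ≤ ∑ i ∈ Finset.range (Nat.log 2 W + 1), 750000 * (D:ℝ)^4 *
        ((A.card:ℝ)^((3:ℝ)/2) * W^4 + (A.card:ℝ)^2 * W^6 / X) := Finset.sum_le_sum h5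
    _ = ((Nat.log 2 W : ℝ) + 1) * (750000 * (D:ℝ)^4 *
        ((A.card:ℝ)^((3:ℝ)/2) * W^4 + (A.card:ℝ)^2 * W^6 / X)) := by
        rw [Finset.sum_const, Finset.card_range, nsmul_eq_mul]; push_cast; ring
    _ ≤ D * (750000 * (D:ℝ)^4 *
        ((A.card:ℝ)^((3:ℝ)/2) * W^4 + (A.card:ℝ)^2 * W^6 / X)) := by gcongr
    _ = _ := by ring

theorem aux_Sp (X W D : ℕ) (hW : 1 ≤ W) (hWX : W ≤ X) (hD1 : 1 ≤ D)
    (hD : ∀ n, 1 ≤ n → n ≤ X^2 → n.divisors.card ≤ D)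
    (A : Finset ℕ) (hA : ∀ a ∈ A, 1 ≤ a ∧ a < X) (S : Finset ℕ) (hSA : S ⊆ A)
    (hS : ∀ a ∈ S, ∃ v₂ v₃ v₄ : ℤ, v₂ ≠ 0 ∧ |v₂| ≤ W ∧ |v₃| ≤ W ∧ |v₄| ≤ W ∧
      v₂ * a + v₃ * X + v₄ = 0) :
    (S.card : ℝ) ≤ 3 * (A.card:ℝ)^((1:ℝ)/2) * W * D := by
  classical
  have h1 : (S.card : ℝ) ≤ A.card := by exact_mod_cast Finset.card_le_card hSA
  have h2 : S.card ≤ 9 * W^2 * D := by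
    have hsub : S ⊆ (Finset.Icc (-(W:ℤ)) W ×ˢ Finset.Icc (-(W:ℤ)) W).biUnion
        fun v => auxDv X (v.1 * X + v.2).natAbs := by
      intro a ha
      obtain ⟨v2, v3, v4, hv2, b2, b3, b4, e⟩ := hS a ha
      have haA := hA a (hSA ha)
      rw [Finset.mem_biUnion]
      refine ⟨(v3, v4), ?_, ?_⟩
      · rw [Finset.mem_product, Finset.mem_Icc, Finset.mem_Icc]
        exact ⟨abs_le.mp b3, abs_le.mp b4⟩
      · simp only
        have e2 : v3 * X + v4 = -(v2 * a) := by linarith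
        rw [e2, Int.natAbs_neg, Int.natAbs_mul, Int.natAbs_natCast]
        have hv : v2.natAbs ≤ W := by rw [Int.abs_eq_natAbs] at b2; exact_mod_cast b2
        refine aux_mem_dv _ _ _ (Dvd.intro_left _ rfl) ?_ ?_
        · have : a ≠ 0 := by omega
          simp [hv2, this]
        · rw [sq]; exact Nat.mul_le_mul (hv.trans hWX) haA.2.le
    have hc : (Finset.Icc (-(W:ℤ)) W ×ˢ Finset.Icc (-(W:ℤ)) W).card = (2*W+1)^2 := by
      rw [Finset.card_product, Int.card_Icc]
      have : ((W:ℤ) + 1 - -(W:ℤ)).toNat = 2*W+1 := by omega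
      rw [this]; ring
    calc _ ≤ _ := Finset.card_le_card hsub
      _ ≤ _ := Finset.card_biUnion_le_card_mul _ _ D fun v _ => aux_card_dv X D hD _
      _ = (2*W+1)^2 * D := by rw [hc]
      _ ≤ (3*W)^2 * D := by gcongr; omega
      _ = _ := by ring
  have h2' : (S.card : ℝ) ≤ 9 * (W:ℝ)^2 * D := by exact_mod_cast h2
  have hD1' : (1:ℝ) ≤ D := by exact_mod_cast hD1
  apply (sq_le_sq₀ (by positivity) (by positivity)).mp
  have e3 : ((A.card : ℝ)^((1:ℝ)/2))^2 = (A.card:ℝ) := by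
    rw [← Real.sqrt_eq_rpow, Real.sq_sqrt (by positivity)]
  calc (S.card:ℝ)^2 = S.card * S.card := sq _
    _ ≤ A.card * (9 * (W:ℝ)^2 * D) := by gcongr
    _ = 9 * A.card * W^2 * D * 1 := by ring
    _ ≤ 9 * A.card * W^2 * D * D := by gcongr
    _ = (3 * (A.card:ℝ)^((1:ℝ)/2) * W * D)^2 := by
      rw [mul_pow, mul_pow, mul_pow, e3]; ring

theorem aux_main (X W D : ℕ) (hX : 1 ≤ X) (hW : 1 ≤ W) (hWX : W < X)
    (hD : ∀ n, 1 ≤ n → n ≤ X^2 → n.divisors.card ≤ D) (hlog : Nat.log 2 X + 1 ≤ D)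
    (A : Finset ℕ) (hA : ∀ a ∈ A, 1 ≤ a ∧ a < X) (G : Finset (ℕ × ℕ))
    (hG : ∀ p ∈ G, p.1 ∈ A ∧ p.2 ∈ A ∧ ∃ v₁ v₂ v₃ v₄ : ℤ,
          ¬(v₁ = 0 ∧ v₂ = 0 ∧ v₃ = 0 ∧ v₄ = 0) ∧
          |v₁| ≤ W ∧ |v₂| ≤ W ∧ |v₃| ≤ W ∧ |v₄| ≤ W ∧
          v₁ * (p.1 : ℤ) + v₂ * (p.2 : ℤ) + v₃ * (X : ℤ) + v₄ = 0) :
    (G.card : ℝ) ≤ 1006 * (D:ℝ)^3 * ((A.card : ℝ)^((5:ℝ)/4) * W^2 + (A.card : ℝ)^((3:ℝ)/2) * W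
            + (A.card : ℝ)^((3:ℝ)/2) * W^3 / (X : ℝ)^((1:ℝ)/2)) := by
  classical
  have hXp : (0:ℝ) < X := by exact_mod_cast hX
  have hD1n : 1 ≤ D := by omega
  have hD1 : (1:ℝ) ≤ D := by exact_mod_cast hD1n
  set H := (A ×ˢ A).filter (fun p => auxEdge X W p.1 p.2) with hHdef
  set S : Finset ℕ := A.filter (fun a : ℕ => ∃ v₂ v₃ v₄ : ℤ, v₂ ≠ 0 ∧ |v₂| ≤ W ∧ |v₃| ≤ W ∧ |v₄| ≤ W ∧
      v₂ * a + v₃ * X + v₄ = 0) with hSdef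
  have hsub : G ⊆ H ∪ (A ×ˢ S ∪ S ×ˢ A) := by
    rintro ⟨a, b⟩ hp
    obtain ⟨ha, hb, v1, v2, v3, v4, hne, b1, b2, b3, b4, e⟩ := hG _ hp
    simp only at ha hb e
    simp only [Finset.mem_union, Finset.mem_product, hHdef, hSdef, Finset.mem_filter]
    by_cases h1 : v1 = 0
    · subst h1
      by_cases h2 : v2 = 0
      · exfalso
        subst h2
        have h4 : v4 = 0 := by
          apply Int.eq_zero_of_abs_lt_dvd (m := (X:ℤ)) ⟨-v3, by linarith⟩
          have : (W:ℤ) < X := by exact_mod_cast hWX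
          linarith
        subst h4
        have hX0 : (X:ℤ) ≠ 0 := by positivity
        have h3 : v3 = 0 := by
          have : v3 * (X:ℤ) = 0 := by linarith
          exact (mul_eq_zero.mp this).resolve_right hX0
        exact hne ⟨rfl, rfl, h3, rfl⟩
      · right; left
        exact ⟨ha, hb, v2, v3, v4, h2, b2, b3, b4, by linarith⟩
    · by_cases h2 : v2 = 0
      · subst h2
        right; right
        exact ⟨⟨ha, v1, v3, v4, h1, b1, b3, b4, by linarith⟩, hb⟩
      · left
        refine ⟨⟨ha, hb⟩, ?_⟩
        rcases lt_or_gt_of_ne h1 with h | h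
        · exact ⟨-v1, -v2, -v3, -v4, by linarith, by simpa using h2, by rwa [abs_neg],
            by rwa [abs_neg], by rwa [abs_neg], by rwa [abs_neg], by linarith⟩
        · exact ⟨v1, v2, v3, v4, h, h2, b1, b2, b3, b4, e⟩
  have hcard : (G.card:ℝ) ≤ H.card + 2 * (A.card * S.card) := by
    have : G.card ≤ H.card + (A.card * S.card + S.card * A.card) := by
      calc _ ≤ _ := Finset.card_le_card hsub
        _ ≤ _ := Finset.card_union_le _ _
        _ ≤ H.card + ((A ×ˢ S).card + (S ×ˢ A).card) := by
          gcongr; exact Finset.card_union_le _ _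
        _ = _ := by rw [Finset.card_product, Finset.card_product]
    have h : (G.card:ℝ) ≤ H.card + (A.card * S.card + S.card * A.card) := by exact_mod_cast this
    linarith
  have hSc := aux_Sp X W D hW hWX.le hD1n hD A hA S (Finset.filter_subset _ _)
    (fun a ha => (Finset.mem_filter.mp ha).2)
  have hHc := aux_H X W D hX hW hWX.le hD hlog A hA H (fun p hp => by
    rw [hHdef, Finset.mem_filter, Finset.mem_product] at hp
    exact ⟨hp.1.1, hp.1.2, hp.2⟩)
  have hn0 : (0:ℝ) ≤ A.card := by positivity
  set n : ℝ := (A.card:ℝ) with hn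
  have e1 : n * n^((1:ℝ)/2) = n^((3:ℝ)/2) := by
    rcases hn0.eq_or_lt with h | h
    · rw [← h, Real.zero_rpow (by norm_num), Real.zero_rpow (by norm_num)]; simp
    · nth_rewrite 1 [← Real.rpow_one n]
      rw [← Real.rpow_add h]; norm_num
  have e2 : (n^((5:ℝ)/4))^2 = n * n^((3:ℝ)/2) := by
    rcases hn0.eq_or_lt with h | h
    · rw [← h, Real.zero_rpow (by norm_num)]; simp
    · rw [← Real.rpow_natCast, ← Real.rpow_mul hn0]
      nth_rewrite 2 [← Real.rpow_one n]
      rw [← Real.rpow_add h]; norm_num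
  have e3 : (n^((3:ℝ)/2))^2 = n * n^2 := by
    rw [← Real.rpow_natCast, ← Real.rpow_mul hn0]; norm_num; ring
  have e4 : ((X:ℝ)^((1:ℝ)/2))^2 = X := by
    rw [← Real.sqrt_eq_rpow, Real.sq_sqrt hXp.le]
  have hx0 : 0 < (X:ℝ)^((1:ℝ)/2) := by positivity
  have hHb : (H.card:ℝ) ≤ 1000 * (D:ℝ)^3 * (n^((5:ℝ)/4) * W^2 + n^((3:ℝ)/2) * W^3 / (X : ℝ)^((1:ℝ)/2)) := by
    apply (sq_le_sq₀ (by positivity) (by positivity)).mp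
    refine hHc.trans ?_
    have hA1 : 0 ≤ n^((5:ℝ)/4) * (W:ℝ)^2 := by positivity
    have hB1 : 0 ≤ n^((3:ℝ)/2) * (W:ℝ)^3 / (X : ℝ)^((1:ℝ)/2) := by positivity
    have hAs : (n^((5:ℝ)/4) * (W:ℝ)^2)^2 = n * (n^((3:ℝ)/2) * W^4) := by
      rw [mul_pow, e2]; ring
    have hBs : (n^((3:ℝ)/2) * (W:ℝ)^3 / (X : ℝ)^((1:ℝ)/2))^2 = n * (n^2 * W^6 / X) := by
      rw [div_pow, mul_pow, e3, e4]; ring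
    generalize n^((5:ℝ)/4) * (W:ℝ)^2 = a1 at *
    generalize n^((3:ℝ)/2) * (W:ℝ)^3 / (X : ℝ)^((1:ℝ)/2) = b1 at *
    calc _ = 750000 * (D:ℝ)^5 * (a1^2 + b1^2) := by rw [hAs, hBs]; ring
      _ ≤ 1000000 * (D:ℝ)^6 * (a1 + b1)^2 := by
        gcongr
        · norm_num
        · norm_num
        · nlinarith [mul_nonneg hA1 hB1]
      _ = _ := by ring
  have hSb : 2 * (n * (S.card:ℝ)) ≤ 6 * (D:ℝ)^3 * (n^((3:ℝ)/2) * W) := by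
    calc 2 * (n * (S.card:ℝ)) ≤ 2 * (n * (3 * n^((1:ℝ)/2) * W * D)) := by gcongr
      _ = 6 * (D:ℝ) * ((n * n^((1:ℝ)/2)) * W) := by ring
      _ = 6 * (D:ℝ) * (n^((3:ℝ)/2) * W) := by rw [e1]
      _ ≤ _ := by
        gcongr
        exact le_self_pow₀ hD1 (by norm_num)
  have p1 : 0 ≤ (D:ℝ)^3 * (n^((5:ℝ)/4) * W^2) := by positivity
  have p2 : 0 ≤ (D:ℝ)^3 * (n^((3:ℝ)/2) * W) := by positivity
  have p3 : 0 ≤ (D:ℝ)^3 * (n^((3:ℝ)/2) * W^3 / (X : ℝ)^((1:ℝ)/2)) := by positivity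
  nlinarith

theorem stmt_12 (ε : ℝ) (hε : 0 < ε) : ∃ C : ℝ, 0 < C ∧
    ∀ (X : ℕ) (𝒞 : Finset ℕ) (V : ℝ),
      1 ≤ X → (∀ a ∈ 𝒞, 1 ≤ a ∧ a < X) → 1 ≤ V →
      (({p : ℕ × ℕ | p.1 ∈ 𝒞 ∧ p.2 ∈ 𝒞 ∧ ∃ v₁ v₂ v₃ v₄ : ℤ,
          ¬(v₁ = 0 ∧ v₂ = 0 ∧ v₃ = 0 ∧ v₄ = 0) ∧
          |(v₁ : ℝ)| ≤ V ∧ |(v₂ : ℝ)| ≤ V ∧ |(v₃ : ℝ)| ≤ V ∧ |(v₄ : ℝ)| ≤ V ∧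
          v₁ * (p.1 : ℤ) + v₂ * (p.2 : ℤ) + v₃ * (X : ℤ) + v₄ = 0}).ncard : ℝ)
        ≤ C * (X : ℝ)^ε * ((𝒞.card : ℝ)^((5:ℝ)/4) * V^2 + (𝒞.card : ℝ)^((3:ℝ)/2) * V
            + (𝒞.card : ℝ)^((3:ℝ)/2) * V^3 / (X : ℝ)^((1:ℝ)/2)) := by
  obtain ⟨C, hC1, hC⟩ := aux_divisor_bound (ε/6) (by positivity)
  refine ⟨1006 * C^3, by positivity, ?_⟩
  intro X A V hX hA hV
  classical
  have hXp : (0:ℝ) < X := by exact_mod_cast hX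
  have hX1 : (1:ℝ) ≤ X := by exact_mod_cast hX
  have hXe : (1:ℝ) ≤ (X:ℝ)^ε := Real.one_le_rpow hX1 hε.le
  set Gs : Set (ℕ × ℕ) := {p : ℕ × ℕ | p.1 ∈ A ∧ p.2 ∈ A ∧ ∃ v₁ v₂ v₃ v₄ : ℤ,
          ¬(v₁ = 0 ∧ v₂ = 0 ∧ v₃ = 0 ∧ v₄ = 0) ∧
          |(v₁ : ℝ)| ≤ V ∧ |(v₂ : ℝ)| ≤ V ∧ |(v₃ : ℝ)| ≤ V ∧ |(v₄ : ℝ)| ≤ V ∧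
          v₁ * (p.1 : ℤ) + v₂ * (p.2 : ℤ) + v₃ * (X : ℤ) + v₄ = 0} with hGs
  have hsub : Gs ⊆ ((A ×ˢ A : Finset (ℕ × ℕ)) : Set (ℕ × ℕ)) := by
    intro p hp
    rw [Finset.mem_coe, Finset.mem_product]
    exact ⟨hp.1, hp.2.1⟩
  have hfin : Gs.Finite := (A ×ˢ A).finite_toSet.subset hsub
  have hV0 : 0 ≤ V := by linarith
  have hn0 : (0:ℝ) ≤ A.card := by positivity
  by_cases hVX : (X:ℝ) ≤ V
  · have h1 : (Gs.ncard : ℝ) ≤ (A.card:ℝ)^2 := by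
      have h := Set.ncard_le_ncard hsub (A ×ˢ A).finite_toSet
      rw [Set.ncard_coe_finset, Finset.card_product] at h
      rw [sq]; exact_mod_cast h
    have h2 : (A.card:ℝ) ≤ V := le_trans (by exact_mod_cast aux_card_le_X X A hA) hVX
    have h3 : (A.card:ℝ)^2 ≤ (A.card:ℝ)^((5:ℝ)/4) * V^2 := by
      rcases Nat.eq_zero_or_pos A.card with h | h
      · rw [h]; simp
      · have hn1 : (1:ℝ) ≤ A.card := by exact_mod_cast h
        have := Real.one_le_rpow hn1 (show (0:ℝ) ≤ 5/4 by norm_num)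
        calc (A.card:ℝ)^2 ≤ V^2 := by gcongr
          _ = 1 * V^2 := by ring
          _ ≤ _ := by gcongr
    have h4 : 1 ≤ 1006 * C^3 * (X:ℝ)^ε := by
      have : 1 ≤ C^3 := one_le_pow₀ hC1
      nlinarith
    calc _ ≤ (A.card:ℝ)^((5:ℝ)/4) * V^2 := h1.trans h3
      _ ≤ (A.card : ℝ)^((5:ℝ)/4) * V^2 + (A.card : ℝ)^((3:ℝ)/2) * V
            + (A.card : ℝ)^((3:ℝ)/2) * V^3 / (X : ℝ)^((1:ℝ)/2) := by
          have : 0 ≤ (A.card : ℝ)^((3:ℝ)/2) * V := by positivity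
          have : 0 ≤ (A.card : ℝ)^((3:ℝ)/2) * V^3 / (X : ℝ)^((1:ℝ)/2) := by positivity
          linarith
      _ = 1 * ((A.card : ℝ)^((5:ℝ)/4) * V^2 + (A.card : ℝ)^((3:ℝ)/2) * V
            + (A.card : ℝ)^((3:ℝ)/2) * V^3 / (X : ℝ)^((1:ℝ)/2)) := by ring
      _ ≤ _ := by gcongr
  · push Not at hVX
    obtain ⟨W, hWdef⟩ : ∃ W : ℕ, W = ⌊V⌋₊ := ⟨_, rfl⟩
    have hWV : (W:ℝ) ≤ V := by rw [hWdef]; exact Nat.floor_le hV0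
    have hW1 : 1 ≤ W := by rw [hWdef]; exact Nat.le_floor (by exact_mod_cast hV)
    have hWX : W < X := by
      have : (W:ℝ) < X := by linarith
      exact_mod_cast this
    have hvW : ∀ v : ℤ, |(v:ℝ)| ≤ V → |v| ≤ (W:ℤ) := by
      intro v hv
      have h : ((v.natAbs : ℕ) : ℝ) ≤ V := by
        rw [Nat.cast_natAbs]; push_cast; exact hv
      have h' := Nat.le_floor h
      rw [← hWdef] at h'
      rw [Int.abs_eq_natAbs]; exact_mod_cast h'
    obtain ⟨D, hDdef⟩ : ∃ D : ℕ, D = ⌊C * (X:ℝ)^(ε/3)⌋₊ := ⟨_, rfl⟩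
    have hDR : (D:ℝ) ≤ C * (X:ℝ)^(ε/3) := by rw [hDdef]; exact Nat.floor_le (by positivity)
    have hD : ∀ n, 1 ≤ n → n ≤ X^2 → n.divisors.card ≤ D := by
      intro n hn1 hn2
      rw [hDdef]
      apply Nat.le_floor
      refine (hC n hn1).trans ?_
      have hn2' : (n:ℝ) ≤ (X:ℝ)^(2:ℝ) := by
        rw [Real.rpow_two]; exact_mod_cast hn2
      gcongr
      calc (n:ℝ)^(ε/6) ≤ ((X:ℝ)^(2:ℝ))^(ε/6) := by gcongr
        _ = _ := by rw [← Real.rpow_mul hXp.le]; congr 1; ring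
    have hlog : Nat.log 2 X + 1 ≤ D := by
      have h := hD (2^(Nat.log 2 X)) Nat.one_le_two_pow
        ((Nat.pow_log_le_self 2 (by omega)).trans (Nat.le_self_pow (by norm_num) X))
      rwa [Nat.divisors_prime_pow Nat.prime_two, Finset.card_map, Finset.card_range] at h
    have hm := aux_main X W D hX hW1 hWX hD hlog A hA hfin.toFinset (by
      intro p hp
      rw [Set.Finite.mem_toFinset] at hp
      obtain ⟨h1, h2, v1, v2, v3, v4, hne, b1, b2, b3, b4, e⟩ := hp
      exact ⟨h1, h2, v1, v2, v3, v4, hne, hvW _ b1, hvW _ b2, hvW _ b3, hvW _ b4, e⟩)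
    rw [← Set.ncard_eq_toFinset_card _ hfin] at hm
    refine hm.trans ?_
    have hD3 : 1006 * (D:ℝ)^3 ≤ 1006 * C^3 * (X:ℝ)^ε := by
      have e : ((X:ℝ)^(ε/3))^3 = (X:ℝ)^ε := by
        rw [← Real.rpow_natCast, ← Real.rpow_mul hXp.le]; congr 1; push_cast; ring
      calc 1006 * (D:ℝ)^3 ≤ 1006 * (C * (X:ℝ)^(ε/3))^3 := by gcongr
        _ = _ := by rw [mul_pow, e]; ring
    gcongr
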